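/- arXiv:2404.01510 — 2 statements merged into one kernel-verified Lean document; each statement's English description precedes it below -/
import Mathlib

section
/- Let X be a simply connected finite CW complex with a homotopy fibration (S^{2d-1})^n → X → (CP^∞)^n, d ≥ 3, such that H*(X;ℤ) = ℤ[t₁,…,t_n]/(q₁,…,q_n) with |t_i| = 2 and |q_i| = 2d. Then the sequence q₁,…,q_n is a regular sequence in ℤ[t₁,…,t_n]. -/
open RingTheory.Sequence IsLocalRing CategoryTheory CategoryTheory.Abelian Pointwise

theorem coheight_le_supportDim {S M : Type*} [CommRing S] [AddCommGroup M] [Module S M]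
    (P : PrimeSpectrum S) (hP : P ∈ Module.support S M) :
    ((Order.coheight P : ℕ∞) : WithBot ℕ∞) ≤ Module.supportDim S M := by
  rw [Order.coheight_eq_krullDim_Ici]
  exact Order.krullDim_le_of_strictMono
    (fun a : Set.Ici P => (⟨a.1, Module.mem_support_mono a.2 hP⟩ : Module.support S M))
    (fun {_ _} lt => lt)

theorem length_le_coheight {S : Type*} [CommRing S] [IsNoetherianRing S] [IsLocalRing S]
    (rs : List S) : ∀ {M : Type*} [AddCommGroup M] [Module S M] [Module.Finite S M]
    (_ : ∀ r ∈ rs, r ∈ maximalIdeal S) (_ : IsWeaklyRegular M rs)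
    (P : PrimeSpectrum S) (_ : ∃ u : M, u ≠ 0 ∧ ∀ a ∈ P.asIdeal, a • u = 0)
    (_ : IsAssociatedPrime P.asIdeal M),
    (rs.length : ℕ∞) ≤ Order.coheight P := by
  induction rs with
  | nil => intros; simp
  | cons x rs ih =>
    intro M _ _ _ hmem hreg P hu hP
    rw [isWeaklyRegular_cons_iff] at hreg
    obtain ⟨hx, hrs⟩ := hreg
    have hxm : x ∈ maximalIdeal S := hmem x (by simp)
    have hxP : x ∉ P.asIdeal := by
      intro h
      obtain ⟨u, hu0, hu⟩ := hu
      exact hu0 (hx.right_eq_zero_of_smul (hu x h))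
    -- the submodule killed by `P`
    obtain ⟨u, huN, hux⟩ : ∃ u : M, (∀ a ∈ P.asIdeal, a • u = 0) ∧ u ∉ x • (⊤ : Submodule S M) := by
      by_contra! hcon
      let N : Submodule S M := Submodule.torsionBySet S M P.asIdeal
      have hN : ∀ v, v ∈ N ↔ ∀ a ∈ P.asIdeal, a • v = 0 := by
        intro v; simp [N, Submodule.mem_torsionBySet_iff]
      have hbot : N = ⊥ := by
        refine Submodule.eq_bot_of_le_smul_of_le_jacobson_bot (Ideal.span {x}) N
          (IsNoetherian.noetherian N) ?_ ?_
        · intro v hv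
          have h1 := hcon v ((hN v).1 hv)
          obtain ⟨w, -, rfl⟩ := (Submodule.mem_smul_pointwise_iff_exists _ _ _).1 h1
          rw [Submodule.ideal_span_singleton_smul]
          refine Submodule.smul_mem_pointwise_smul _ _ _ ((hN w).2 fun a ha => ?_)
          apply hx.right_eq_zero_of_smul
          rw [smul_comm]
          exact (hN _).1 hv a ha
        · rw [Ideal.span_singleton_le_iff_mem, jacobson_eq_maximalIdeal _ bot_ne_top]
          exact hxm
      obtain ⟨u, hu0, hu⟩ := hu
      have : u ∈ N := (hN u).2 hu
      rw [hbot] at this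
      exact hu0 (by simpa using this)
    have hne : (Submodule.mkQ (x • (⊤ : Submodule S M)) u) ≠ 0 := by
      simpa using hux
    obtain ⟨Q, hQ, hle⟩ := exists_le_isAssociatedPrime_of_isNoetherianRing S
      (Submodule.mkQ (x • (⊤ : Submodule S M)) u) hne
    have hQp := hQ.isPrime
    have hkill : ∀ a : S, a • (Submodule.mkQ (x • (⊤ : Submodule S M)) u) = 0 → a ∈ Q := by
      intro a ha
      apply hle
      simpa [Submodule.mem_colon_singleton] using ha
    have hPQ : P < ⟨Q, hQp⟩ := by
      refine lt_of_le_of_ne ?_ ?_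
      · intro a ha
        apply hkill
        rw [← map_smul, huN a ha, map_zero]
      · rintro rfl
        apply hxP
        apply hkill
        rw [← map_smul, Submodule.mkQ_apply, Submodule.Quotient.mk_eq_zero]
        exact Submodule.smul_mem_pointwise_smul _ _ _ trivial
    have h2 : (rs.length : ℕ∞) ≤ Order.coheight (⟨Q, hQp⟩ : PrimeSpectrum S) := by
      refine ih (M := QuotSMulTop x M) (fun r hr => hmem r (by simp [hr])) hrs _ ?_ hQ
      obtain ⟨-, v, hv⟩ := isAssociatedPrime_iff.1 hQ
      refine ⟨v, ?_, ?_⟩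
      · rintro rfl
        apply hQp.ne_top
        rw [hv]
        ext; simp
      · intro a ha
        have ha' : a ∈ Q := ha
        rw [hv] at ha'
        simpa [Submodule.mem_colon_singleton] using ha'
    calc ((x :: rs).length : ℕ∞) = rs.length + 1 := by simp
      _ ≤ Order.coheight (⟨Q, hQp⟩ : PrimeSpectrum S) + 1 := by gcongr
      _ ≤ Order.coheight P := Order.coheight_add_one_le hPQ

theorem supportDim_le_add_length {S : Type*} [CommRing S] [IsNoetherianRing S] [IsLocalRing S]
    (ys : List S) : ∀ {M : Type*} [AddCommGroup M] [Module S M] [Module.Finite S M]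
    (_ : ∀ r ∈ ys, r ∈ maximalIdeal S),
    Module.supportDim S M ≤
      Module.supportDim S (M ⧸ (Ideal.ofList ys • (⊤ : Submodule S M))) + ys.length := by
  induction ys with
  | nil =>
    intro M _ _ _ _
    simp only [List.length_nil, Nat.cast_zero, add_zero]
    refine Module.supportDim_le_of_injective (Submodule.mkQ _) ?_
    rw [← LinearMap.ker_eq_bot]
    simp
  | cons y ys ih =>
    intro M _ _ _ hmem
    have h1 := Module.supportDim_le_supportDim_quotSMulTop_succ (M := M) (hmem y (by simp))
    have h2 := ih (M := QuotSMulTop y M) (fun r hr => hmem r (by simp [hr]))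
    have h3 := Module.supportDim_eq_of_equiv
      (Submodule.quotOfListConsSMulTopEquivQuotSMulTopInner M y ys)
    rw [h3]
    refine h1.trans ?_
    calc _ ≤ _ + 1 := add_le_add_left h2 1
      _ = _ := by rw [add_assoc]; simp

universe u

/-- Depth drops by at most one modulo a regular element. -/
theorem exists_regular_quot {S : Type u} [CommRing S] [IsNoetherianRing S] [IsLocalRing S]
    {M : Type u} [AddCommGroup M] [Module S M] [Module.Finite S M] [Nontrivial M]
    (e : ℕ) (y : S) (hy : y ∈ maximalIdeal S) (hreg : IsSMulRegular M y)
    (h : ∃ rs : List S, rs.length = e + 1 ∧ (∀ r ∈ rs, r ∈ maximalIdeal S) ∧ IsRegular M rs) :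
    ∃ rs : List S, rs.length = e ∧ (∀ r ∈ rs, r ∈ maximalIdeal S) ∧
      IsRegular (QuotSMulTop y M) rs := by
  have hlt : ∀ (N : Type u) [AddCommGroup N] [Module S N] [Module.Finite S N] [Nontrivial N],
      maximalIdeal S • (⊤ : Submodule S N) < ⊤ := by
    intro N _ _ _ _
    refine lt_top_iff_ne_top.2 fun heq => ?_
    have := Submodule.eq_bot_of_le_smul_of_le_jacobson_bot (maximalIdeal S) (⊤ : Submodule S N)
      Module.Finite.fg_top heq.ge (by rw [jacobson_eq_maximalIdeal _ bot_ne_top])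
    exact top_ne_bot this
  have hnt : Nontrivial (QuotSMulTop y M) := by
    apply Submodule.Quotient.nontrivial_iff.mpr
    intro heq
    have h1 := hlt M
    have h2 : (⊤ : Submodule S M) ≤ maximalIdeal S • ⊤ := by
      refine heq.ge.trans ?_
      rw [← Submodule.ideal_span_singleton_smul]
      exact Submodule.smul_mono_left ((Ideal.span_singleton_le_iff_mem _).2 hy)
    exact absurd (lt_of_lt_of_le h1 h2) (lt_irrefl _)
  have h2 := ((ModuleCat.exists_isRegular_tfae (maximalIdeal S) (e+1) (ModuleCat.of S M)
    (hlt M)).out 1 3).2 h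
  refine ((ModuleCat.exists_isRegular_tfae (maximalIdeal S) e (ModuleCat.of S (QuotSMulTop y M))
    (hlt (QuotSMulTop y M))).out 1 3).1 ?_
  intro i hi
  have zero1 := AddCommGrpCat.isZero_of_iff_subsingleton.mpr (h2 i (by omega))
  have zero2 := AddCommGrpCat.isZero_of_iff_subsingleton.mpr (h2 (i + 1) (by omega))
  exact AddCommGrpCat.subsingleton_of_isZero <| ShortComplex.Exact.isZero_of_both_zeros
    ((Ext.covariant_sequence_exact₃' _
      (IsSMulRegular.smulShortComplex_shortExact (M := ModuleCat.of S M) hreg)) i (i + 1) rfl)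
        (zero1.eq_zero_of_src _) (zero2.eq_zero_of_tgt _)

theorem isWeaklyRegular_of_supportDim {S : Type u} [CommRing S] [IsNoetherianRing S]
    [IsLocalRing S] (ys : List S) : ∀ {M : Type u} [AddCommGroup M] [Module S M]
    [Module.Finite S M] [Nontrivial M] (e : ℕ) (_ : ys.length = e)
    (_ : ∀ r ∈ ys, r ∈ maximalIdeal S)
    (_ : ∃ rs : List S, rs.length = e ∧ (∀ r ∈ rs, r ∈ maximalIdeal S) ∧ IsRegular M rs)
    (_ : Module.supportDim S (M ⧸ (Ideal.ofList ys • (⊤ : Submodule S M))) ≤ 0),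
    IsWeaklyRegular M ys := by
  induction ys with
  | nil => intros; simp
  | cons y ys ih =>
    intro M _ _ _ _ e he hmem hdepth hdim
    obtain rfl : e = ys.length + 1 := by simpa using he.symm
    have hy : y ∈ maximalIdeal S := hmem y (by simp)
    have hys : ∀ r ∈ ys, r ∈ maximalIdeal S := fun r hr => hmem r (by simp [hr])
    rw [Module.supportDim_eq_of_equiv
      (Submodule.quotOfListConsSMulTopEquivQuotSMulTopInner M y ys)] at hdim
    have hd := supportDim_le_add_length ys (M := QuotSMulTop y M) hys
    have hd' : Module.supportDim S (QuotSMulTop y M) ≤ (ys.length : ℕ) := by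
      refine hd.trans ?_
      calc _ ≤ 0 + _ := add_le_add_left hdim _
        _ = _ := by simp
    have hyreg : IsSMulRegular M y := by
      by_contra hcon
      have hmemU : y ∈ ⋃ p ∈ associatedPrimes S M, (p : Set S) := by
        rw [biUnion_associatedPrimes_eq_compl_regular]
        exact hcon
      simp only [Set.mem_iUnion] at hmemU
      obtain ⟨P, hP, hyP⟩ := hmemU
      have hPp : P.IsPrime := IsAssociatedPrime.isPrime hP
      obtain ⟨-, v, hv⟩ := isAssociatedPrime_iff.1 hP
      obtain ⟨rs, hlen, hrm, hrr⟩ := hdepth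
      have h1 := length_le_coheight rs hrm hrr.toIsWeaklyRegular ⟨P, hPp⟩
        ⟨v, by
          rintro rfl
          apply hPp.ne_top
          rw [hv]
          ext; simp, by
          intro a ha
          have ha' : a ∈ P := ha
          rw [hv] at ha'
          simpa [Submodule.mem_colon_singleton] using ha'⟩ hP
      have hsup : (⟨P, hPp⟩ : PrimeSpectrum S) ∈ Module.support S (QuotSMulTop y M) := by
        rw [Module.support_quotSMulTop]
        refine ⟨?_, ?_⟩
        · rw [Module.mem_support_iff_of_finite]
          intro a ha
          show a ∈ P
          rw [hv]
          simpa [Submodule.mem_colon_singleton] using Module.mem_annihilator.1 ha v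
        · simpa using hyP
      have h2 := coheight_le_supportDim _ hsup
      rw [hlen] at h1
      have h3 : (((ys.length + 1 : ℕ) : ℕ∞) : WithBot ℕ∞) ≤ ((ys.length : ℕ∞) : WithBot ℕ∞) :=
        (WithBot.coe_le_coe.2 h1).trans (h2.trans hd')
      have h4 := WithBot.coe_le_coe.1 h3
      have h5 := Nat.cast_le.1 h4
      omega
    rw [isWeaklyRegular_cons_iff]
    have hq := exists_regular_quot ys.length y hy hyreg hdepth
    have : Nontrivial (QuotSMulTop y M) := by
      obtain ⟨rs, -, -, h⟩ := hq
      exact h.nontrivial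
    exact ⟨hyreg, ih ys.length rfl hys hq hdim⟩

open MvPolynomial in
theorem weaklyRegular_X (n : ℕ) (p : ℤ) (hp : p ≠ 0) :
    IsWeaklyRegular (MvPolynomial (Fin n) ℤ)
      (List.ofFn (fun i : Fin n => (X i : MvPolynomial (Fin n) ℤ)) ++ [C p]) := by
  have hspan : ∀ i ≤ n, Ideal.ofList ((List.ofFn
      (fun i : Fin n => (X i : MvPolynomial (Fin n) ℤ))).take i)
      = Ideal.span (X '' {j : Fin n | (j : ℕ) < i}) := by
    intro i hi
    unfold Ideal.ofList
    congr 1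
    ext f
    simp only [Set.mem_ofPred_eq, Set.mem_image, List.mem_take_iff_getElem]
    constructor
    · rintro ⟨j, hj, rfl⟩
      simp only [List.length_ofFn, lt_inf_iff] at hj
      exact ⟨⟨j, hj.2⟩, hj.1, by simp⟩
    · rintro ⟨j, hj, rfl⟩
      exact ⟨j, by simp; omega, by simp⟩
  rw [isWeaklyRegular_append_iff]
  constructor
  · rw [isWeaklyRegular_iff]
    intro i hi
    have hi' : i < n := by simpa using hi
    rw [isSMulRegular_quotient_iff_mem_of_smul_mem]
    intro z hz
    simp only [smul_eq_mul, Ideal.mul_top, hspan i hi'.le, List.getElem_ofFn,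
      mem_ideal_span_X_image, support_X_mul] at hz ⊢
    intro m hm
    obtain ⟨j, hj, hjm⟩ := hz _ (Finset.mem_map_of_mem _ hm)
    refine ⟨j, hj, ?_⟩
    have hne : (⟨i, hi'⟩ : Fin n) ≠ j := by
      rintro rfl
      simp at hj
    simpa [Finsupp.single_apply, hne] using hjm
  · rw [isWeaklyRegular_singleton_iff, isSMulRegular_quotient_iff_mem_of_smul_mem]
    have h := hspan n le_rfl
    rw [List.take_of_length_le (by simp)] at h
    intro z hz
    simp only [smul_eq_mul, Ideal.mul_top, h, mem_ideal_span_X_image] at hz ⊢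
    intro m hm
    apply hz
    simp only [mem_support_iff, coeff_C_mul] at hm ⊢
    exact mul_ne_zero hp hm

open MvPolynomial in
theorem local_regular (n d : ℕ) (hd : 3 ≤ d) (q : Fin n → MvPolynomial (Fin n) ℤ)
    (hq : ∀ i, (q i).IsHomogeneous d)
    (hfin : Module.Finite ℤ
      (MvPolynomial (Fin n) ℤ ⧸ Ideal.span (Set.range q)))
    (p : ℤ) (hp : Prime p) (m : Ideal (MvPolynomial (Fin n) ℤ)) [hm : m.IsMaximal]
    (S : Type) [CommRing S] [IsLocalRing S] [IsNoetherianRing S]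
    [Algebra (MvPolynomial (Fin n) ℤ) S] [IsLocalization.AtPrime S m]
    (hmem : ∀ f, f ∈ m ↔ p ∣ constantCoeff f) :
    IsWeaklyRegular S
      ((List.ofFn q).map (algebraMap _ S)) := by
  have hqm : ∀ i, q i ∈ m := by
    intro i
    rw [hmem, constantCoeff_eq, (hq i).coeff_eq_zero (by simp; omega)]
    exact dvd_zero _
  have hpm : C p ∈ m := by rw [hmem]; simp
  have hXm : ∀ i, X i ∈ m := by intro i; rw [hmem]; simp
  have hloc : ∀ f ∈ m, algebraMap _ S f ∈
      maximalIdeal S := by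
    intro f hf
    exact (IsLocalization.AtPrime.to_map_mem_maximal_iff _ m f).2 hf
  have key : IsWeaklyRegular S
      ((List.ofFn q ++ [C p]).map (algebraMap _ S)) := by
    refine isWeaklyRegular_of_supportDim _ (n + 1) (by simp) ?_ ?_ ?_
    · intro r hr
      obtain ⟨f, hf, rfl⟩ := List.mem_map.1 hr
      apply hloc
      simp only [List.mem_append, List.mem_ofFn, List.mem_singleton] at hf
      rcases hf with ⟨i, rfl⟩ | rfl
      · exact hqm i
      · exact hpm
    · have hX : ∀ f ∈ (List.ofFn (fun i : Fin n => (X i : MvPolynomial (Fin n) ℤ)) ++ [C p]),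
          f ∈ m := by
        intro f hf
        simp only [List.mem_append, List.mem_ofFn, List.mem_singleton] at hf
        rcases hf with ⟨i, rfl⟩ | rfl
        · exact hXm i
        · exact hpm
      refine ⟨(List.ofFn (fun i : Fin n => (X i : MvPolynomial (Fin n) ℤ)) ++ [C p]).map
        (algebraMap _ S), by simp, ?_, ?_⟩
      · intro r hr
        obtain ⟨f, hf, rfl⟩ := List.mem_map.1 hr
        exact hloc f (hX f hf)
      · exact (weaklyRegular_X n p hp.ne_zero).isRegular_of_isLocalization_of_mem _ m hX
    · unfold Module.supportDim
      have hsub : ∀ Q ∈ Module.support S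
          (S ⧸ (Ideal.ofList ((List.ofFn q ++ [C p]).map
            (algebraMap _ S)) •
              (⊤ : Submodule S S))),
          Q.asIdeal = maximalIdeal S := by
        intro Q hQ
        rw [Module.mem_support_iff_of_finite, smul_eq_mul, Ideal.mul_top,
          Ideal.annihilator_quotient, ← Ideal.map_ofList, Ideal.map_le_iff_le_comap] at hQ
        let Q' := Q.asIdeal.comap (algebraMap (MvPolynomial (Fin n) ℤ) S)
        have hQ'p : Q'.IsPrime := Ideal.comap_isPrime _ _
        have hIQ : Ideal.span (Set.range q) ≤ Q' := by
          rw [Ideal.span_le]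
          rintro _ ⟨i, rfl⟩
          exact hQ (Ideal.subset_span (by simp))
        have hpQ : C p ∈ Q' := hQ (Ideal.subset_span (by simp))
        have hfinQ : Module.Finite ℤ (MvPolynomial (Fin n) ℤ ⧸ Q') :=
          Module.Finite.of_surjective
            (Ideal.Quotient.factor hIQ).toAddMonoidHom.toIntLinearMap
            (Ideal.Quotient.factor_surjective hIQ)
        have hmax : Q'.IsMaximal := by
          rw [← Ideal.bot_quotient_isMaximal_iff]
          refine Ideal.isMaximal_of_isIntegral_of_isMaximal_comap (R := ℤ) _ ?_
          have hpm' : (Ideal.span {p}).IsMaximal :=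
            PrincipalIdealRing.isMaximal_of_irreducible hp.irreducible
          have hle : Ideal.span {p} ≤
              (⊥ : Ideal (MvPolynomial (Fin n) ℤ ⧸ Q')).comap (algebraMap ℤ _) := by
            rw [Ideal.span_singleton_le_iff_mem, Ideal.mem_comap, Ideal.mem_bot]
            have := Ideal.Quotient.eq_zero_iff_mem.2 hpQ
            simpa using this
          have hne : (⊥ : Ideal (MvPolynomial (Fin n) ℤ ⧸ Q')).comap (algebraMap ℤ _) ≠ ⊤ :=
            Ideal.comap_ne_top _ bot_ne_top
          rw [← hpm'.eq_of_le hne hle]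
          exact hpm'
        have hQm : Q' ≤ m := by
          intro f hf
          have := le_maximalIdeal Q.2.ne_top (show algebraMap _ _ f ∈ Q.asIdeal from hf)
          exact (IsLocalization.AtPrime.to_map_mem_maximal_iff _ m f).1 this
        have hQeq : Q' = m := hmax.eq_of_le hm.ne_top hQm
        have h1 := IsLocalization.map_under m.primeCompl S Q.asIdeal
        rw [← h1]
        change Ideal.map _ Q' = _
        rw [hQeq]
        exact IsLocalization.AtPrime.map_eq_maximalIdeal m S
      have : Subsingleton (Module.support S
          (S ⧸ (Ideal.ofList ((List.ofFn q ++ [C p]).map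
            (algebraMap _ S)) •
              (⊤ : Submodule S S)))) := by
        constructor
        rintro ⟨a, ha⟩ ⟨b, hb⟩
        apply Subtype.ext
        apply PrimeSpectrum.ext
        rw [hsub a ha, hsub b hb]
      exact Order.krullDim_nonpos_of_subsingleton
  rw [List.map_append, isWeaklyRegular_append_iff] at key
  exact key.1

attribute [local instance] MvPolynomial.gradedAlgebra

open MvPolynomial in
theorem homComp_mul (n d k : ℕ) (f z : MvPolynomial (Fin n) ℤ) (hf : f.IsHomogeneous d) :
    homogeneousComponent (d + k) (f * z) = f * homogeneousComponent k z := by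
  have h := DirectSum.coe_decompose_mul_add_of_left_mem (homogeneousSubmodule (Fin n) ℤ)
    (i := d) (j := k) (a := f) (b := z) ((mem_homogeneousSubmodule _ _).2 hf)
  rw [← decomposition.decompose'_apply, ← decomposition.decompose'_apply]
  exact h

open MvPolynomial in
theorem homComp_mem {n : ℕ} (J : Ideal (MvPolynomial (Fin n) ℤ))
    (hJ : J.IsHomogeneous (homogeneousSubmodule (Fin n) ℤ)) (k : ℕ) (f) (hf : f ∈ J) :
    homogeneousComponent k f ∈ J := by
  exact (mem_iff_homogeneousComponent_mem hJ f).1 hf k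

open MvPolynomial in
theorem stmt3 (n d : ℕ) (hd : 3 ≤ d) (q : Fin n → MvPolynomial (Fin n) ℤ)
    (hq : ∀ i, (q i).IsHomogeneous d)
    (hfin : Module.Finite ℤ
      (MvPolynomial (Fin n) ℤ ⧸ Ideal.span (Set.range q))) :
    RingTheory.Sequence.IsRegular (MvPolynomial (Fin n) ℤ) (List.ofFn q) := by
  constructor
  · rw [isWeaklyRegular_iff]
    intro i hi
    have hi' : i < n := by simpa using hi
    rw [isSMulRegular_quotient_iff_mem_of_smul_mem]
    intro z hz
    simp only [smul_eq_mul, Ideal.mul_top, List.getElem_ofFn] at hz ⊢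
    set J := Ideal.ofList ((List.ofFn q).take i) with hJdef
    have hJ : J.IsHomogeneous (homogeneousSubmodule (Fin n) ℤ) := by
      apply Ideal.homogeneous_span
      intro f hf
      have hf' := List.mem_of_mem_take hf
      obtain ⟨j, rfl⟩ := (List.mem_ofFn' _ _).1 hf'
      exact ⟨d, (mem_homogeneousSubmodule _ _).2 (hq j)⟩
    rw [← sum_homogeneousComponent z]
    refine Ideal.sum_mem _ fun k _ => ?_
    have hzk : q ⟨i, hi'⟩ * homogeneousComponent k z ∈ J := by
      rw [← homComp_mul n d k _ _ (hq _)]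
      exact homComp_mem J hJ _ _ hz
    have hwk : (homogeneousComponent k z).IsHomogeneous k := homogeneousComponent_isHomogeneous _ _
    generalize homogeneousComponent k z = w at hzk hwk
    let b : Ideal ℤ := (Submodule.colon J {w}).comap (C : ℤ →+* MvPolynomial (Fin n) ℤ)
    have hb : ∀ c, c ∈ b ↔ C c * w ∈ J := by
      intro c
      simp [b, Submodule.mem_colon_singleton]
    by_cases hbt : b = ⊤
    · have h1 : (1 : ℤ) ∈ b := by rw [hbt]; trivial
      simpa [hb] using h1
    exfalso
    obtain ⟨M, hM, hbM⟩ := Ideal.exists_le_maximal b hbt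
    obtain ⟨p, hp, rfl⟩ : ∃ p : ℤ, Prime p ∧ M = Ideal.span {p} := by
      obtain ⟨p, rfl⟩ := (IsPrincipalIdealRing.principal M).principal
      have hp0 : p ≠ 0 := by
        rintro rfl
        have : (⊥ : Ideal ℤ).IsMaximal := by simpa using hM
        exact Int.not_isField (Ring.isField_iff_maximal_bot.2 this)
      exact ⟨p, (Ideal.span_singleton_prime hp0).1 hM.isPrime, rfl⟩
    let m : Ideal (MvPolynomial (Fin n) ℤ) := Ideal.comap constantCoeff (Ideal.span {p})
    have hm : m.IsMaximal :=
      Ideal.comap_isMaximal_of_surjective _ (fun c => ⟨C c, by simp⟩)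
    have hmem : ∀ f, f ∈ m ↔ p ∣ constantCoeff f := by
      intro f
      rw [Ideal.mem_comap, Ideal.mem_span_singleton]
    have hreg := local_regular n d hd q hq hfin p hp m (Localization.AtPrime m) hmem
    rw [isWeaklyRegular_iff] at hreg
    have h1 := hreg i (by simpa using hi')
    rw [isSMulRegular_quotient_iff_mem_of_smul_mem] at h1
    have h2 := h1 (algebraMap _ _ w)
    simp only [smul_eq_mul, Ideal.mul_top, List.getElem_map, List.getElem_ofFn, ← List.map_take,
      ← Ideal.map_ofList, ← map_mul] at h2
    have h3 := h2 (Ideal.mem_map_of_mem _ hzk)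
    obtain ⟨s, hs, hsw⟩ :=
      (IsLocalization.algebraMap_mem_map_algebraMap_iff m.primeCompl _ _ _).1 h3
    apply hs
    show s ∈ m
    rw [hmem, ← Ideal.mem_span_singleton]
    apply hbM
    rw [hb]
    have h4 := homComp_mem J hJ (k + 0) _ hsw
    rw [mul_comm, homComp_mul n k 0 _ _ hwk, homogeneousComponent_zero, mul_comm] at h4
    simpa [constantCoeff_eq] using h4
  · intro htop
    have h1 : (1 : MvPolynomial (Fin n) ℤ) ∈ Ideal.ofList (List.ofFn q) := by
      have : (1 : MvPolynomial (Fin n) ℤ) ∈ (⊤ : Ideal (MvPolynomial (Fin n) ℤ)) := trivial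
      rw [htop] at this
      simpa using this
    have hle : Ideal.ofList (List.ofFn q) ≤
        RingHom.ker (constantCoeff : MvPolynomial (Fin n) ℤ →+* ℤ) := by
      unfold Ideal.ofList
      rw [Ideal.span_le]
      intro f hf
      obtain ⟨j, rfl⟩ := (List.mem_ofFn' _ _).1 hf
      show constantCoeff (q j) = 0
      rw [constantCoeff_eq, (hq j).coeff_eq_zero (by simp; omega)]
    have := hle h1
    simp at this
end

section
/- Let k be a positive integer and n ≥ 1. If A and B are connected graded rings each having a nontrivial element of degree two, then H(k,n) is not isomorphic to A ⊗ B as a graded ring. -/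
open MvPolynomial

/- The graded ring H(k,n) = ℤ[t₁,…,t_n]/(t₁⁴+kt₁³t₂, …, t_{n-1}⁴+kt_{n-1}³t_n, t_n⁴)
with |t_i| = 2.  We index the `n` variables t₁,…,t_n of the paper by `Fin n`;
a homogeneous element of topological degree `2*j` is (the class of) a polynomial
that is homogeneous of polynomial degree `j`. -/

/-- The ideal (t₁⁴+kt₁³t₂, …, t_{n-1}⁴+k t_{n-1}³t_n, t_n⁴), with the `n`
variables indexed by `Fin (n+1)` for `n+1` variables... -/
noncomputable def Hideal (k n : ℕ) : Ideal (MvPolynomial (Fin (n + 1)) ℤ) :=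
  Ideal.span ({X (Fin.last n) ^ 4} ∪
    Set.range fun i : Fin n =>
      X (Fin.castSucc i) ^ 4 + (k : ℤ) • (X (Fin.castSucc i) ^ 3 * X i.succ))

/-- The ring `H(k, n+1 vars)`: `H k n` has `n+1` variables `t₀,…,t_n`,
so it is the ring H(k, n+1) of the paper. -/
noncomputable abbrev HRing (k n : ℕ) : Type :=
  MvPolynomial (Fin (n + 1)) ℤ ⧸ Hideal k n

/-- The generator t_i of H(k,n). -/
noncomputable def Ht (k n : ℕ) (i : Fin (n + 1)) : HRing k n :=
  Ideal.Quotient.mk _ (X i)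

/-- A ring homomorphism `HRing k n → HRing l n` preserves the grading (all
gradings in sight are concentrated in even topological degrees `2*j`) if it
sends classes of homogeneous polynomials of degree `j` to classes of
homogeneous polynomials of degree `j`, for every `j`. -/
def PreservesGrading {k l n : ℕ} (f : HRing k n →+* HRing l n) : Prop :=
  ∀ (j : ℕ) (x : MvPolynomial (Fin (n + 1)) ℤ), x.IsHomogeneous j →
    ∃ y : MvPolynomial (Fin (n + 1)) ℤ, y.IsHomogeneous j ∧
      f (Ideal.Quotient.mk _ x) = Ideal.Quotient.mk _ y

/-- A graded (ring/algebra) isomorphism H(k,n) ≅ H(l,n): a ring isomorphism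
preserving the grading in both directions.  (Every ring homomorphism between
these rings is automatically a ℤ-algebra homomorphism.) -/
def IsGradedIso {k l n : ℕ} (f : HRing k n ≃+* HRing l n) : Prop :=
  PreservesGrading (f : HRing k n →+* HRing l n) ∧
    PreservesGrading (f.symm : HRing l n →+* HRing k n)

open TensorProduct in
/-- The degree-`d` component of the tensor product `A ⊗ B` of graded rings:
the span of products of a degree-`i` and a degree-`j` element with `i + j = d`. -/
noncomputable def tensorGrade {A B : Type} [CommRing A] [CommRing B]
    (𝒜 : ℕ → Submodule ℤ A) (ℬ : ℕ → Submodule ℤ B) (d : ℕ) :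
    Submodule ℤ (A ⊗[ℤ] B) :=
  ⨆ (p : ℕ × ℕ) (_ : p.1 + p.2 = d),
    Submodule.map₂ (TensorProduct.mk ℤ A B) (𝒜 p.1) (ℬ p.2)

/-- The degree-`d` component of `H(k,n)` (topological grading: the variables
have degree 2, so degree `d = 2*j` consists of classes of homogeneous
polynomials of polynomial degree `j`, and odd degrees vanish). -/
noncomputable def Hgrade (k n d : ℕ) : Submodule ℤ (HRing k n) :=
  if 2 ∣ d then
    Submodule.map (Ideal.Quotient.mkₐ ℤ (Hideal k n)).toLinearMap
      (MvPolynomial.homogeneousSubmodule (Fin (n + 1)) ℤ (d / 2))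
  else ⊥

/-- Elements of the ideal have no coefficients in degree `< 4`. -/
lemma aux_coeff_ideal (k n : ℕ) (x : MvPolynomial (Fin (n + 1)) ℤ) (hx : x ∈ Hideal k n) :
    ∀ m : Fin (n + 1) →₀ ℕ, m.degree < 4 → coeff m x = 0 := by
  have hom : ∀ g ∈ ({X (Fin.last n) ^ 4} ∪ Set.range fun i : Fin n =>
      X (Fin.castSucc i) ^ 4 + (k : ℤ) • (X (Fin.castSucc i) ^ 3 * X i.succ) :
      Set (MvPolynomial (Fin (n + 1)) ℤ)), g.IsHomogeneous 4 := by
    rintro g (hg | ⟨i, rfl⟩)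
    · rw [Set.mem_singleton_iff.1 hg]
      simpa using (isHomogeneous_X ℤ (Fin.last n)).pow 4
    · refine IsHomogeneous.add ?_ ?_
      · simpa using (isHomogeneous_X ℤ (Fin.castSucc i)).pow 4
      · refine (homogeneousSubmodule (Fin (n+1)) ℤ 4).smul_mem _ ?_
        have := ((isHomogeneous_X ℤ (Fin.castSucc i)).pow 3).mul (isHomogeneous_X ℤ i.succ)
        simpa using this
  unfold Hideal at hx
  induction hx using Submodule.span_induction with
  | mem g hg => exact fun m hm => (hom g hg).coeff_eq_zero (by omega)
  | zero => simp
  | add x y _ _ hx hy => intro m hm; simp [hx m hm, hy m hm]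
  | smul r x _ hx =>
    intro m hm
    classical
    rw [smul_eq_mul, coeff_mul]
    refine Finset.sum_eq_zero fun p hp => ?_
    rw [Finset.HasAntidiagonal.mem_antidiagonal] at hp
    have : p.1.degree + p.2.degree = m.degree := by rw [← hp, map_add]
    rw [hx p.2 (by omega), mul_zero]

/-- Coefficient functionals in low degree descend to the quotient. -/
lemma aux_functional (k n : ℕ) (m : Fin (n + 1) →₀ ℕ) (hm : m.degree < 4) :
    ∃ c : HRing k n →+ ℤ, ∀ P, c (Ideal.Quotient.mk _ P) = coeff m P :=
  ⟨QuotientAddGroup.lift (Hideal k n).toAddSubgroup (coeffAddMonoidHom m)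
    (fun x hx => aux_coeff_ideal k n x hx m hm), fun _ => rfl⟩

lemma aux_mem_grade {k n j : ℕ} {x : HRing k n} (hx : x ∈ Hgrade k n (2 * j)) :
    ∃ P : MvPolynomial (Fin (n + 1)) ℤ, P.IsHomogeneous j ∧ Ideal.Quotient.mk _ P = x := by
  unfold Hgrade at hx
  rw [if_pos (Dvd.intro _ rfl)] at hx
  obtain ⟨P, hP, rfl⟩ := hx
  rw [Nat.mul_div_cancel_left _ (by norm_num)] at hP
  exact ⟨P, hP, rfl⟩

lemma aux_X_mem (k n : ℕ) (i : Fin (n + 1)) : Ht k n i ∈ Hgrade k n 2 := by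
  unfold Hgrade
  rw [if_pos (dvd_refl _)]
  exact ⟨X i, isHomogeneous_X ℤ i, rfl⟩

lemma aux_hom_sep {k n j : ℕ} (hj : j < 4) {P : MvPolynomial (Fin (n + 1)) ℤ}
    (hP : P.IsHomogeneous j) (h0 : P ≠ 0) :
    ∃ c : HRing k n →+ ℤ, c (Ideal.Quotient.mk _ P) ≠ 0 := by
  obtain ⟨m, hm⟩ := ne_zero_iff.1 h0
  have hd : m.degree = j := by
    by_contra h
    exact hm (hP.coeff_eq_zero h)
  obtain ⟨c, hc⟩ := aux_functional k n m (by omega)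
  exact ⟨c, by rw [hc]; exact hm⟩

lemma aux_sep {k n j : ℕ} (hj : j < 4) {x : HRing k n} (hx : x ∈ Hgrade k n (2 * j))
    (h0 : x ≠ 0) : ∃ c : HRing k n →+ ℤ, c x ≠ 0 := by
  obtain ⟨P, hP, rfl⟩ := aux_mem_grade hx
  exact aux_hom_sep hj hP (by rintro rfl; simp at h0)

lemma aux_pow {k n e : ℕ} (he : e < 4) {x : HRing k n} (hx : x ∈ Hgrade k n 2)
    (h0 : x ≠ 0) : ∃ c : HRing k n →+ ℤ, c (x ^ e) ≠ 0 := by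
  obtain ⟨P, hP, rfl⟩ := aux_mem_grade (j := 1) hx
  rw [← map_pow]
  refine aux_hom_sep (j := e) he (by simpa using hP.pow e) (pow_ne_zero _ ?_)
  rintro rfl
  simp at h0

lemma aux_Ht_pow {k n e : ℕ} (he : e < 4) (i : Fin (n + 1)) :
    ∃ c : HRing k n →+ ℤ, c (Ht k n i ^ e) ≠ 0 := by
  unfold Ht
  rw [← map_pow]
  exact aux_hom_sep (j := e) he (by simpa using (isHomogeneous_X ℤ i).pow e)
    (pow_ne_zero _ (X_ne_zero i))

lemma aux_rel_last (k n : ℕ) : Ht k n (Fin.last n) ^ 4 = 0 := by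
  unfold Ht
  rw [← map_pow, Ideal.Quotient.eq_zero_iff_mem]
  exact Ideal.subset_span (Or.inl rfl)

lemma aux_rel (k n : ℕ) (i : Fin n) :
    Ht k n i.castSucc ^ 4 + (k : HRing k n) * (Ht k n i.castSucc ^ 3 * Ht k n i.succ) = 0 := by
  have : Ideal.Quotient.mk (Hideal k n)
      (X (Fin.castSucc i) ^ 4 + (k : ℤ) • (X (Fin.castSucc i) ^ 3 * X i.succ)) = 0 :=
    Ideal.Quotient.eq_zero_iff_mem.2 (Ideal.subset_span (Or.inr ⟨i, rfl⟩))
  rw [zsmul_eq_mul] at this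
  simpa [Ht] using this

lemma aux_proj {A : Type} [CommRing A] (𝒜 : ℕ → Submodule ℤ A)
    (h : DirectSum.IsInternal 𝒜) : ∃ π : ℕ → A →+ A,
      (∀ i x, x ∈ 𝒜 i → π i x = x) ∧ (∀ i j x, x ∈ 𝒜 j → j ≠ i → π i x = 0) := by
  let := h.chooseDecomposition
  refine ⟨fun i => AddMonoidHom.mk' (fun x => (DirectSum.decompose 𝒜 x i : A)) ?_, ?_, ?_⟩
  · intro a b
    simp
  · intro i x hx
    exact DirectSum.decompose_of_mem_same 𝒜 hx
  · intro i j x hx hij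
    exact DirectSum.decompose_of_mem_ne 𝒜 hx hij

open TensorProduct in
lemma aux_contract {A B : Type} [CommRing A] [CommRing B] (φ : A →+ ℤ) :
    ∃ Φ : A ⊗[ℤ] B →+ B, ∀ a b, Φ (a ⊗ₜ b) = φ a • b :=
  ⟨((TensorProduct.lid ℤ B).toLinearMap ∘ₗ
    (LinearMap.rTensor B φ.toIntLinearMap)).toAddMonoidHom, fun a b => by simp⟩

open TensorProduct in
/-- The data which are used, in a form that is symmetric in `A` and `B`. -/
structure AuxData (k n : ℕ) (A B : Type) [CommRing A] [CommRing B]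
    (𝒜 : ℕ → Submodule ℤ A) (ℬ : ℕ → Submodule ℤ B) (f : HRing k n ≃+* (A ⊗[ℤ] B)) : Prop where
  internal : DirectSum.IsInternal 𝒜
  one : (1 : A) ∈ 𝒜 0
  mul : ∀ i j a a', a ∈ 𝒜 i → a' ∈ 𝒜 j → a * a' ∈ 𝒜 (i + j)
  left : ∀ d a, a ∈ 𝒜 d → f.symm (a ⊗ₜ 1) ∈ Hgrade k n d
  right : ∀ d b, b ∈ ℬ d → f.symm (1 ⊗ₜ b) ∈ Hgrade k n d
  split : ∀ i, ∃ a ∈ 𝒜 2, ∃ b ∈ ℬ 2, f (Ht k n i) = a ⊗ₜ 1 + 1 ⊗ₜ b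

open TensorProduct in
/-- If the contraction of `x ⊗ b ^ e` vanishes then `x ⊗ 1 = 0` or `1 ⊗ b = 0`. -/
lemma aux_vanish {k n : ℕ} {A B : Type} [CommRing A] [CommRing B]
    {𝒜 : ℕ → Submodule ℤ A} {ℬ : ℕ → Submodule ℤ B} {f : HRing k n ≃+* (A ⊗[ℤ] B)}
    (D : AuxData k n A B 𝒜 ℬ f) {j e : ℕ} (hj : j < 4) (he : e < 4) {x : A} (hx : x ∈ 𝒜 (2 * j))
    {b : B} (hb : b ∈ ℬ 2) (hb0 : (1 : A) ⊗ₜ[ℤ] b ≠ 0)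
    (h : ∀ φ : A →+ ℤ, (∀ i a, a ∈ 𝒜 i → i ≠ 2 * j → φ a = 0) → φ x • b ^ e = 0) :
    x ⊗ₜ[ℤ] (1 : B) = 0 := by
  by_contra hx0
  obtain ⟨π, hπ1, hπ2⟩ := aux_proj 𝒜 D.internal
  obtain ⟨c, hc⟩ := aux_pow (e := e) he (D.right 2 b hb) (by simpa using hb0)
  obtain ⟨c', hc'⟩ := aux_sep hj (D.left (2 * j) x hx) (by simpa using hx0)
  have hL : ∃ L : A →+ HRing k n, ∀ a, L a = f.symm (a ⊗ₜ 1) :=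
    ⟨((f.symm : (A ⊗[ℤ] B) →+* HRing k n).comp
      Algebra.TensorProduct.includeLeftRingHom).toAddMonoidHom, fun a => rfl⟩
  obtain ⟨L, hL⟩ := hL
  have h1 := h ((c'.comp L).comp (π (2 * j))) (by
    intro i a ha hi
    simp [hπ2 _ _ _ ha hi])
  have h2 : (1 : A) ⊗ₜ[ℤ] ((((c'.comp L).comp (π (2 * j))) x) • b ^ e) = 0 := by
    rw [h1, tmul_zero]
  rw [AddMonoidHom.comp_apply, AddMonoidHom.comp_apply, hπ1 _ _ hx, hL, tmul_smul] at h2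
  have h3 := congrArg (fun z => c (f.symm z)) h2
  simp only [map_zero, map_zsmul] at h3
  have h4 : (1 : A) ⊗ₜ[ℤ] (b ^ e) = ((1 : A) ⊗ₜ[ℤ] b) ^ e := by
    simp [Algebra.TensorProduct.tmul_pow]
  rw [h4, map_pow, smul_eq_mul] at h3
  exact (mul_ne_zero hc' hc) h3

open TensorProduct in
lemma aux_key {k n : ℕ} {A B : Type} [CommRing A] [CommRing B]
    {𝒜 : ℕ → Submodule ℤ A} {ℬ : ℕ → Submodule ℤ B} {f : HRing k n ≃+* (A ⊗[ℤ] B)}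
    (D : AuxData k n A B 𝒜 ℬ f) {a y : A} (ha : a ∈ 𝒜 2) (hy : y ∈ 𝒜 2)
    {b : B} (hb : b ∈ ℬ 2) (hb0 : (1 : A) ⊗ₜ[ℤ] b ≠ 0)
    (h : (a ⊗ₜ[ℤ] (1 : B) + 1 ⊗ₜ b) ^ 4 +
      (k : A ⊗[ℤ] B) * ((a ⊗ₜ[ℤ] (1 : B) + 1 ⊗ₜ b) ^ 3 * (y ⊗ₜ 1)) = 0) :
    (4 • a + k • y) ⊗ₜ[ℤ] (1 : B) = 0 ∧ (6 • a ^ 2 + (3 * k) • (a * y)) ⊗ₜ[ℤ] (1 : B) = 0 := by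
  have e : (a ^ 4 + k • (a ^ 3 * y)) ⊗ₜ[ℤ] (1 : B) + (4 • a ^ 3 + (3 * k) • (a ^ 2 * y)) ⊗ₜ[ℤ] b
      + (6 • a ^ 2 + (3 * k) • (a * y)) ⊗ₜ[ℤ] (b ^ 2) + (4 • a + k • y) ⊗ₜ[ℤ] (b ^ 3)
      + 1 ⊗ₜ (b ^ 4) = 0 := by
    rw [← h]
    have t : ∀ (u : A) (v : B), u ⊗ₜ[ℤ] v = Algebra.TensorProduct.includeLeftRingHom u *
        (Algebra.TensorProduct.includeRight : B →ₐ[ℤ] A ⊗[ℤ] B) v := by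
      intro u v
      simp
    simp only [t, map_add, map_mul, map_pow, map_one, nsmul_eq_mul, map_natCast, map_ofNat]
    push_cast
    ring
  have a2 : a ^ 2 ∈ 𝒜 4 := by rw [pow_two]; exact D.mul 2 2 _ _ ha ha
  have a3 : a ^ 3 ∈ 𝒜 6 := by rw [pow_succ]; exact D.mul 4 2 _ _ a2 ha
  have a4 : a ^ 4 ∈ 𝒜 8 := by rw [pow_succ]; exact D.mul 6 2 _ _ a3 ha
  have m8 : a ^ 4 + k • (a ^ 3 * y) ∈ 𝒜 8 :=
    add_mem a4 (nsmul_mem (D.mul 6 2 _ _ a3 hy) _)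
  have m6 : 4 • a ^ 3 + (3 * k) • (a ^ 2 * y) ∈ 𝒜 6 :=
    add_mem (nsmul_mem a3 _) (nsmul_mem (D.mul 4 2 _ _ a2 hy) _)
  have m4 : 6 • a ^ 2 + (3 * k) • (a * y) ∈ 𝒜 4 :=
    add_mem (nsmul_mem a2 _) (nsmul_mem (D.mul 2 2 _ _ ha hy) _)
  have m2 : 4 • a + k • y ∈ 𝒜 2 :=
    add_mem (nsmul_mem ha _) (nsmul_mem hy _)
  constructor
  · refine aux_vanish D (j := 1) (e := 3) (by norm_num) (by norm_num) m2 hb hb0 fun φ hφ => ?_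
    obtain ⟨Φ, hΦ⟩ := aux_contract (B := B) φ
    have := congrArg Φ e
    rw [map_add, map_add, map_add, map_add, hΦ, hΦ, hΦ, hΦ, hΦ, hφ 8 _ m8 (by norm_num),
      hφ 6 _ m6 (by norm_num), hφ 4 _ m4 (by norm_num), hφ 0 _ D.one (by norm_num)] at this
    simpa only [zero_smul, zero_add, add_zero, map_zero] using this
  · refine aux_vanish D (j := 2) (e := 2) (by norm_num) (by norm_num) m4 hb hb0 fun φ hφ => ?_
    obtain ⟨Φ, hΦ⟩ := aux_contract (B := B) φ
    have := congrArg Φ e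
    rw [map_add, map_add, map_add, map_add, hΦ, hΦ, hΦ, hΦ, hΦ, hφ 8 _ m8 (by norm_num),
      hφ 6 _ m6 (by norm_num), hφ 2 _ m2 (by norm_num), hφ 0 _ D.one (by norm_num)] at this
    simpa only [zero_smul, zero_add, add_zero, map_zero] using this

open TensorProduct in
lemma aux_last {k n : ℕ} {A B : Type} [CommRing A] [CommRing B]
    {𝒜 : ℕ → Submodule ℤ A} {ℬ : ℕ → Submodule ℤ B} {f : HRing k n ≃+* (A ⊗[ℤ] B)}
    (D : AuxData k n A B 𝒜 ℬ f) :
    (∃ a ∈ 𝒜 2, f (Ht k n (Fin.last n)) = a ⊗ₜ 1) ∨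
    (∃ b ∈ ℬ 2, f (Ht k n (Fin.last n)) = 1 ⊗ₜ b) := by
  obtain ⟨a, ha, b, hb, hab⟩ := D.split (Fin.last n)
  by_cases hb0 : (1 : A) ⊗ₜ[ℤ] b = 0
  · left
    exact ⟨a, ha, by rw [hab, hb0, add_zero]⟩
  right
  have h := (aux_key D ha (zero_mem (𝒜 2)) hb hb0 (by
    rw [← hab, ← map_pow, aux_rel_last]
    simp)).1
  refine ⟨b, hb, ?_⟩
  suffices ha0 : a ⊗ₜ[ℤ] (1 : B) = 0 by rw [hab, ha0, zero_add]
  by_contra ha0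
  obtain ⟨c, hc⟩ := aux_sep (j := 1) (by norm_num) (D.left 2 a ha) (by simpa using ha0)
  have h' : (4 : ℕ) • (a ⊗ₜ[ℤ] (1 : B)) = 0 := by
    rw [← h, smul_zero, add_zero, smul_tmul']
  have := congrArg (fun z => c (f.symm z)) h'
  rw [map_nsmul, map_nsmul, map_zero, map_zero, nsmul_eq_mul] at this
  exact hc (by push_cast at this; omega)

open TensorProduct in
lemma aux_core {k n : ℕ} (hk : 0 < k) {A B : Type} [CommRing A] [CommRing B]
    {𝒜 : ℕ → Submodule ℤ A} {ℬ : ℕ → Submodule ℤ B} {f : HRing k n ≃+* (A ⊗[ℤ] B)}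
    (D : AuxData k n A B 𝒜 ℬ f) (hB2 : ℬ 2 ≠ ⊥)
    (hlast : ∃ a ∈ 𝒜 2, f (Ht k n (Fin.last n)) = a ⊗ₜ 1) : False := by
  have all : ∀ i, ∃ a ∈ 𝒜 2, f (Ht k n i) = a ⊗ₜ 1 := by
    intro i
    induction i using Fin.reverseInduction with
    | last => exact hlast
    | cast i ih =>
      obtain ⟨y, hy, hfy⟩ := ih
      obtain ⟨a, ha, b, hb, hab⟩ := D.split i.castSucc
      refine ⟨a, ha, ?_⟩
      suffices hb0 : (1 : A) ⊗ₜ[ℤ] b = 0 by rw [hab, hb0, add_zero]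
      by_contra hb0
      obtain ⟨h1, h2⟩ := aux_key D ha hy hb hb0 (by
        rw [← hab, ← hfy, ← map_pow, ← map_pow, ← map_mul, ← map_natCast f, ← map_mul,
          ← map_add, aux_rel, map_zero])
      obtain ⟨c, hc⟩ := aux_Ht_pow (k := k) (e := 2) (by norm_num) i.succ
      set u := f.symm (a ⊗ₜ 1) with hu
      have ht : Ht k n i.succ = f.symm (y ⊗ₜ 1) := by rw [← hfy]; simp
      set t := Ht k n i.succ
      have h1' : 4 * u + k * t = 0 := by
        have := congrArg f.symm h1
        rw [add_tmul, ← smul_tmul', ← smul_tmul', map_add, map_nsmul, map_nsmul, map_zero,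
          ← ht, ← hu] at this
        simpa using this
      have h2' : 6 * u ^ 2 + (3 * k) * (u * t) = 0 := by
        have := congrArg f.symm h2
        have e1 : (a ^ 2) ⊗ₜ[ℤ] (1 : B) = (a ⊗ₜ[ℤ] (1 : B)) ^ 2 := by
          simp [Algebra.TensorProduct.tmul_pow]
        have e2 : (a * y) ⊗ₜ[ℤ] (1 : B) = (a ⊗ₜ[ℤ] (1 : B)) * (y ⊗ₜ[ℤ] (1 : B)) := by
          simp
        rw [add_tmul, ← smul_tmul', ← smul_tmul', map_add, map_nsmul, map_nsmul, map_zero,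
          e1, e2, map_pow, map_mul, ← ht, ← hu] at this
        simpa using this
      have h3 : (3 * k ^ 2 : ℕ) • t ^ 2 = 0 := by
        rw [nsmul_eq_mul]
        push_cast
        linear_combination (-8 : HRing k n) * h2' + (12 * u + 3 * k * t) * h1'
      have h4 := congrArg c h3
      rw [map_nsmul, map_zero, nsmul_eq_mul] at h4
      refine mul_ne_zero ?_ hc h4
      have : 3 * k ^ 2 ≠ 0 := by positivity
      exact_mod_cast this
  obtain ⟨b, hb, hb0⟩ := Submodule.exists_mem_ne_zero_of_ne_bot hB2
  -- the image of `b` is a linear combination of the generators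
  have lin : ∀ P : MvPolynomial (Fin (n + 1)) ℤ, P.IsHomogeneous 1 →
      ∃ a ∈ 𝒜 2, f (Ideal.Quotient.mk _ P) = a ⊗ₜ 1 := by
    intro P hP
    choose g hg hfg using all
    rw [← mem_homogeneousSubmodule, homogeneousSubmodule_one_eq_span_X] at hP
    induction hP using Submodule.span_induction with
    | mem x hx =>
      obtain ⟨i, rfl⟩ := hx
      exact ⟨g i, hg i, hfg i⟩
    | zero => exact ⟨0, zero_mem _, by simp⟩
    | add x y _ _ hx hy =>
      obtain ⟨a, ha, h⟩ := hx
      obtain ⟨a', ha', h'⟩ := hy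
      exact ⟨a + a', add_mem ha ha', by rw [map_add, map_add, h, h', add_tmul]⟩
    | smul r x _ hx =>
      obtain ⟨a, ha, h⟩ := hx
      refine ⟨r • a, (𝒜 2).smul_mem _ ha, ?_⟩
      rw [map_zsmul, map_zsmul, h, smul_tmul']
  obtain ⟨P, hP, hPb⟩ := aux_mem_grade (j := 1) (D.right 2 b hb)
  obtain ⟨a, ha, hPa⟩ := lin P hP
  rw [hPb, RingEquiv.apply_symm_apply] at hPa
  obtain ⟨π, hπ1, hπ2⟩ := aux_proj 𝒜 D.internal
  obtain ⟨c, hc⟩ := aux_functional k n 0 (by simp)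
  have hL : ∃ L : A →+ HRing k n, ∀ a, L a = f.symm (a ⊗ₜ 1) :=
    ⟨((f.symm : (A ⊗[ℤ] B) →+* HRing k n).comp
      Algebra.TensorProduct.includeLeftRingHom).toAddMonoidHom, fun a => rfl⟩
  obtain ⟨L, hL⟩ := hL
  obtain ⟨Φ, hΦ⟩ := aux_contract (B := B) ((c.comp L).comp (π 0))
  have h := congrArg Φ hPa
  rw [hΦ, hΦ, AddMonoidHom.comp_apply, AddMonoidHom.comp_apply, AddMonoidHom.comp_apply,
    AddMonoidHom.comp_apply, hπ1 _ _ D.one, hπ2 _ _ _ ha (by norm_num), hL,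
    ← Algebra.TensorProduct.one_def, map_one, ← map_one (Ideal.Quotient.mk (Hideal k n)), hc,
    coeff_zero_one, one_smul, map_zero, map_zero, zero_smul] at h
  exact hb0 h

open TensorProduct in
lemma aux_split {k n : ℕ} {A B : Type} [CommRing A] [CommRing B]
    {𝒜 : ℕ → Submodule ℤ A} {ℬ : ℕ → Submodule ℤ B} {f : HRing k n ≃+* (A ⊗[ℤ] B)}
    (hAconn : 𝒜 0 = Submodule.span ℤ {(1 : A)})
    (hBconn : ℬ 0 = Submodule.span ℤ {(1 : B)})
    (left : ∀ d a, a ∈ 𝒜 d → f.symm (a ⊗ₜ 1) ∈ Hgrade k n d)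
    (z : A ⊗[ℤ] B) (hz : z ∈ tensorGrade 𝒜 ℬ 2) :
    ∃ a ∈ 𝒜 2, ∃ b ∈ ℬ 2, z = a ⊗ₜ 1 + 1 ⊗ₜ b := by
  let S : Submodule ℤ (A ⊗[ℤ] B) :=
    (𝒜 2).map ((TensorProduct.mk ℤ A B).flip 1) ⊔ (ℬ 2).map (TensorProduct.mk ℤ A B 1)
  have hS : tensorGrade 𝒜 ℬ 2 ≤ S := by
    unfold tensorGrade
    refine iSup_le fun p => iSup_le fun hp => Submodule.map₂_le.2 fun a ha b hb => ?_
    obtain ⟨i, j⟩ := p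
    simp only at hp ha hb
    have : i = 0 ∨ i = 1 ∨ i = 2 := by omega
    rcases this with rfl | rfl | rfl
    · obtain rfl : j = 2 := by omega
      rw [hAconn] at ha
      obtain ⟨r, rfl⟩ := Submodule.mem_span_singleton.1 ha
      refine Submodule.mem_sup_right ⟨r • b, (ℬ 2).smul_mem _ hb, ?_⟩
      change (1 : A) ⊗ₜ[ℤ] (r • b) = (r • (1 : A)) ⊗ₜ[ℤ] b
      rw [smul_tmul]
    · have h0 := left 1 a ha
      unfold Hgrade at h0
      rw [if_neg (by norm_num), Submodule.mem_bot] at h0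
      have h1 : a ⊗ₜ[ℤ] (1 : B) = 0 := by simpa using h0
      have h2 : a ⊗ₜ[ℤ] b = 0 := by
        have : a ⊗ₜ[ℤ] b = (a ⊗ₜ[ℤ] (1 : B)) * ((1 : A) ⊗ₜ[ℤ] b) := by simp
        rw [this, h1, zero_mul]
      change a ⊗ₜ[ℤ] b ∈ S
      rw [h2]
      exact zero_mem _
    · obtain rfl : j = 0 := by omega
      rw [hBconn] at hb
      obtain ⟨r, rfl⟩ := Submodule.mem_span_singleton.1 hb
      refine Submodule.mem_sup_left ⟨r • a, (𝒜 2).smul_mem _ ha, ?_⟩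
      change (r • a) ⊗ₜ[ℤ] (1 : B) = a ⊗ₜ[ℤ] (r • (1 : B))
      rw [smul_tmul]
  obtain ⟨x, ⟨a, ha, rfl⟩, y, ⟨b, hb, rfl⟩, rfl⟩ := Submodule.mem_sup.1 (hS hz)
  exact ⟨a, ha, b, hb, rfl⟩

open TensorProduct in
/- STATEMENT 11: Let k be a positive integer and n ≥ 1.  If A and B are
connected graded (commutative) rings each having a nontrivial element of
degree two, then H(k,n) is not isomorphic to A ⊗ B as a graded ring.
(`HRing k n` has `n+1` variables, covering all n ≥ 1 of the paper.  A grading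
on a ring A is a family 𝒜 of ℤ-submodules forming an internal direct sum with
1 ∈ 𝒜 0 and 𝒜 i · 𝒜 j ⊆ 𝒜 (i+j); connectedness means 𝒜 0 = ℤ·1.) -/
theorem stmt11 (k n : ℕ) (hk : 0 < k) (A B : Type) [CommRing A] [CommRing B]
    (𝒜 : ℕ → Submodule ℤ A) (ℬ : ℕ → Submodule ℤ B)
    (hAinternal : DirectSum.IsInternal 𝒜) (hBinternal : DirectSum.IsInternal ℬ)
    (hAone : (1 : A) ∈ 𝒜 0) (hBone : (1 : B) ∈ ℬ 0)
    (hAmul : ∀ i j a a', a ∈ 𝒜 i → a' ∈ 𝒜 j → a * a' ∈ 𝒜 (i + j))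
    (hBmul : ∀ i j b b', b ∈ ℬ i → b' ∈ ℬ j → b * b' ∈ ℬ (i + j))
    (hAconn : 𝒜 0 = Submodule.span ℤ {(1 : A)})
    (hBconn : ℬ 0 = Submodule.span ℤ {(1 : B)})
    (hA2 : 𝒜 2 ≠ ⊥) (hB2 : ℬ 2 ≠ ⊥) :
    ¬ ∃ f : HRing k n ≃+* (A ⊗[ℤ] B),
        (∀ d x, x ∈ Hgrade k n d → f x ∈ tensorGrade 𝒜 ℬ d) ∧
        (∀ d y, y ∈ tensorGrade 𝒜 ℬ d → f.symm y ∈ Hgrade k n d) := by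
  rintro ⟨f, hf, hg⟩
  have left : ∀ d a, a ∈ 𝒜 d → f.symm (a ⊗ₜ 1) ∈ Hgrade k n d := by
    intro d a ha
    apply hg
    exact (le_iSup₂_of_le (f := fun (p : ℕ × ℕ) (_ : p.1 + p.2 = d) =>
      Submodule.map₂ (TensorProduct.mk ℤ A B) (𝒜 p.1) (ℬ p.2)) (d, 0) (by simp) le_rfl)
      (Submodule.apply_mem_map₂ _ ha hBone)
  have right : ∀ d b, b ∈ ℬ d → f.symm (1 ⊗ₜ b) ∈ Hgrade k n d := by
    intro d b hb
    apply hg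
    exact (le_iSup₂_of_le (f := fun (p : ℕ × ℕ) (_ : p.1 + p.2 = d) =>
      Submodule.map₂ (TensorProduct.mk ℤ A B) (𝒜 p.1) (ℬ p.2)) (0, d) (by simp) le_rfl)
      (Submodule.apply_mem_map₂ _ hAone hb)
  have split : ∀ i, ∃ a ∈ 𝒜 2, ∃ b ∈ ℬ 2, f (Ht k n i) = a ⊗ₜ 1 + 1 ⊗ₜ b := fun i =>
    aux_split hAconn hBconn left _ (hf 2 _ (aux_X_mem k n i))
  have D : AuxData k n A B 𝒜 ℬ f := ⟨hAinternal, hAone, hAmul, left, right, split⟩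
  let s : (A ⊗[ℤ] B) ≃+* (B ⊗[ℤ] A) := (Algebra.TensorProduct.comm ℤ A B).toRingEquiv
  have hs : ∀ a b, s (a ⊗ₜ b) = b ⊗ₜ a := fun a b => rfl
  have hs' : ∀ a b, s.symm (b ⊗ₜ a) = a ⊗ₜ b := fun a b => rfl
  have D' : AuxData k n B A ℬ 𝒜 (f.trans s) := by
    refine ⟨hBinternal, hBone, hBmul, ?_, ?_, ?_⟩
    · intro d b hb
      rw [RingEquiv.symm_trans_apply, hs']
      exact right d b hb
    · intro d a ha
      rw [RingEquiv.symm_trans_apply, hs']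
      exact left d a ha
    · intro i
      obtain ⟨a, ha, b, hb, h⟩ := split i
      exact ⟨b, hb, a, ha, by rw [RingEquiv.trans_apply, h, map_add, hs, hs, add_comm]⟩
  rcases aux_last D with h | ⟨b, hb, h⟩
  · exact aux_core hk D hB2 h
  · exact aux_core hk D' hA2 ⟨b, hb, by rw [RingEquiv.trans_apply, h, hs]⟩
end
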